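/- Let n > 3, s ≥ 1 and let Λ = (λ_1,…,λ_n), λ_j ∈ ℂ, be weakly hyperbolic. Let W = Z_{(Λ,n,s)} ∩ {w_1 = ⋯ = w_s = 0} and let X ∈ W. Then there exists a smooth (C^∞) curve γ : [0,1] → ℂ^s × ℂ^n with γ(t) ∈ Z_{(Λ,n,s)} for all t, γ(0) = X, γ(t) ∉ W for all t ∈ (0,1], and such that for every t ∈ [0,1] the velocity γ'(t) is a nonzero vector lying in the kernel of α at γ(t), i.e., α_{γ(t)}(γ'(t)) = 0 (γ is a nonsingular Legendrian curve leaving W). -/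

import Mathlib

open scoped BigOperators

/-- `Λ` is weakly hyperbolic (`k = 2`). -/
def WeaklyHyperbolicC {n : ℕ} (Λ : Fin n → ℂ) : Prop :=
  ∀ J : Finset (Fin n), J.card ≤ 2 → (0 : ℂ) ∉ convexHull ℝ (Λ '' ↑J)

/-- The manifold `Z_{(Λ,n,s)} ⊆ ℂ^s × ℂ^n` cut out by
`F_s(w,z) = ∑ w_r² + ∑ λ_j |z_j|² = 0` and `ρ_s(w,z) = ∑ |w_r|² + ∑ |z_j|² = 1`. -/
def ZLS (s : ℕ) {n : ℕ} (Λ : Fin n → ℂ) : Set ((Fin s → ℂ) × (Fin n → ℂ)) :=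
  {X | (∑ r, X.1 r ^ 2) + (∑ j, Λ j * (Complex.normSq (X.2 j) : ℂ)) = 0 ∧
       (∑ r, Complex.normSq (X.1 r)) + (∑ j, Complex.normSq (X.2 j)) = 1}

/-- The tangent space of `Z_{(Λ,n,s)}` at `X = (w,z)`: all `v = (a,b) ∈ ℂ^s × ℂ^n` with
`∑ 2 w_r a_r + ∑ λ_j (conj(z_j) b_j + z_j conj(b_j)) = 0` and
`Re(∑ conj(w_r) a_r + ∑ conj(z_j) b_j) = 0`. -/
def TangentAt (s : ℕ) {n : ℕ} (Λ : Fin n → ℂ)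
    (X v : (Fin s → ℂ) × (Fin n → ℂ)) : Prop :=
  ((∑ r, 2 * X.1 r * v.1 r) +
      (∑ j, Λ j * ((starRingEnd ℂ) (X.2 j) * v.2 j + X.2 j * (starRingEnd ℂ) (v.2 j))) = 0) ∧
  ((∑ r, (starRingEnd ℂ) (X.1 r) * v.1 r) + (∑ j, (starRingEnd ℂ) (X.2 j) * v.2 j)).re = 0

/-- The `1`-form
`α_X(a,b) = i(∑ (w_r conj(a_r) − conj(w_r) a_r) + ∑ (z_j conj(b_j) − conj(z_j) b_j))`. -/
noncomputable def alphaForm {s n : ℕ} (X v : (Fin s → ℂ) × (Fin n → ℂ)) : ℂ :=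
  Complex.I *
    ((∑ r, (X.1 r * (starRingEnd ℂ) (v.1 r) - (starRingEnd ℂ) (X.1 r) * v.1 r)) +
     (∑ j, (X.2 j * (starRingEnd ℂ) (v.2 j) - (starRingEnd ℂ) (X.2 j) * v.2 j)))

/-- The constant `2`-form
`dα(u,v) = 2i(∑ (u_r conj(v_r) − v_r conj(u_r)) + ∑ (u_{s+j} conj(v_{s+j}) − v_{s+j} conj(u_{s+j})))`. -/
noncomputable def dAlpha {s n : ℕ} (u v : (Fin s → ℂ) × (Fin n → ℂ)) : ℂ :=
  2 * Complex.I *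
    ((∑ r, (u.1 r * (starRingEnd ℂ) (v.1 r) - v.1 r * (starRingEnd ℂ) (u.1 r))) +
     (∑ j, (u.2 j * (starRingEnd ℂ) (v.2 j) - v.2 j * (starRingEnd ℂ) (u.2 j))))

/-- The vector `v(T,μ) = −i(2 conj(T) conj(w_1) + μ w_1, …, 2 conj(T) conj(w_s) + μ w_s,
(2 Re(T λ_1) + μ) z_1, …, (2 Re(T λ_n) + μ) z_n)`. -/
noncomputable def vTmu {s n : ℕ} (Λ : Fin n → ℂ) (X : (Fin s → ℂ) × (Fin n → ℂ)) (T : ℂ) (μ : ℝ) :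
    (Fin s → ℂ) × (Fin n → ℂ) :=
  (fun r => -Complex.I * (2 * (starRingEnd ℂ) T * (starRingEnd ℂ) (X.1 r) + (μ : ℂ) * X.1 r),
   fun j => -Complex.I * (((2 * (T * Λ j).re + μ : ℝ) : ℂ) * X.2 j))

/-- `W = Z_{(Λ,n,s)} ∩ {w_1 = ⋯ = w_s = 0}`. -/
def WSet (s : ℕ) {n : ℕ} (Λ : Fin n → ℂ) : Set ((Fin s → ℂ) × (Fin n → ℂ)) :=
  {X | X ∈ ZLS s Λ ∧ X.1 = 0}

/-- A weakly hyperbolic configuration has no vanishing member. -/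
lemma WeaklyHyperbolicC.ne_zero {n : ℕ} {Λ : Fin n → ℂ} (hΛ : WeaklyHyperbolicC Λ) (k : Fin n) :
    Λ k ≠ 0 := by
  intro h
  apply hΛ {k} (by simp)
  simp [h]

/-- `α` vanishes on every vector obtained from the base point by real scalings of a common
frame in each coordinate. -/
lemma alphaForm_real_scaling {s n : ℕ} (v : Fin s → ℂ) (x : Fin n → ℂ)
    (g g' : ℝ) (f f' : Fin n → ℝ) :
    alphaForm (fun r => (g : ℂ) * v r, fun j => (f j : ℂ) * x j)
      (fun r => (g' : ℂ) * v r, fun j => (f' j : ℂ) * x j) = 0 := by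
  have h₁ : ∀ r, (g : ℂ) * v r * (starRingEnd ℂ) ((g' : ℂ) * v r)
      - (starRingEnd ℂ) ((g : ℂ) * v r) * ((g' : ℂ) * v r) = 0 := by
    intro r
    simp only [map_mul, Complex.conj_ofReal]
    ring
  have h₂ : ∀ j, (f j : ℂ) * x j * (starRingEnd ℂ) ((f' j : ℂ) * x j)
      - (starRingEnd ℂ) ((f j : ℂ) * x j) * ((f' j : ℂ) * x j) = 0 := by
    intro j
    simp only [map_mul, Complex.conj_ofReal]
    ring
  simp only [alphaForm, h₁, h₂, Finset.sum_const_zero, add_zero, mul_zero]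

/-- The velocity of a curve moving by real scalings in each coordinate. -/
lemma hasDerivAt_real_scaling {s n : ℕ} (v : Fin s → ℂ) (x : Fin n → ℂ)
    {g : ℝ → ℝ} {f : Fin n → ℝ → ℝ} {g' : ℝ} {f' : Fin n → ℝ} {t : ℝ}
    (hg : HasDerivAt g g' t) (hf : ∀ j, HasDerivAt (f j) (f' j) t) :
    HasDerivAt (fun t => ((fun r => (g t : ℂ) * v r, fun j => (f j t : ℂ) * x j) :
        (Fin s → ℂ) × (Fin n → ℂ)))
      (fun r => (g' : ℂ) * v r, fun j => (f' j : ℂ) * x j) t := by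
  refine HasDerivAt.prodMk (hasDerivAt_pi.2 fun r => ?_) (hasDerivAt_pi.2 fun j => ?_)
  · exact hg.ofReal_comp.mul_const _
  · exact (hf j).ofReal_comp.mul_const _

/-- Every point `X ∈ W` is the starting point of a smooth nonsingular Legendrian curve in
`Z_{(Λ,n,s)}` leaving `W` immediately: `γ(0) = X`, `γ(t) ∉ W` for `t ∈ (0,1]`, and for all
`t ∈ [0,1]` the velocity `γ'(t)` is nonzero and lies in the kernel of `α` at `γ(t)`. -/
theorem legendrian_exit_from_W {n s : ℕ} (hn : 3 < n) (hs : 1 ≤ s)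
    (Λ : Fin n → ℂ) (hΛ : WeaklyHyperbolicC Λ)
    (X : (Fin s → ℂ) × (Fin n → ℂ)) (hX : X ∈ WSet s Λ) :
    ∃ γ : ℝ → (Fin s → ℂ) × (Fin n → ℂ),
      ContDiff ℝ (⊤ : ℕ∞) γ ∧ γ 0 = X ∧
      (∀ t ∈ Set.Icc (0 : ℝ) 1, γ t ∈ ZLS s Λ) ∧
      (∀ t ∈ Set.Ioc (0 : ℝ) 1, γ t ∉ WSet s Λ) ∧
      (∀ t ∈ Set.Icc (0 : ℝ) 1, deriv γ t ≠ 0 ∧ alphaForm (γ t) (deriv γ t) = 0) := by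
  classical
  obtain ⟨⟨hF, hρ⟩, hw⟩ := hX
  obtain ⟨w, x⟩ := X
  simp only at hF hρ hw
  subst hw
  simp only [Pi.zero_apply, ne_eq, OfNat.ofNat_ne_zero, not_false_eq_true, zero_pow,
    Finset.sum_const_zero, zero_add, map_zero] at hF hρ
  obtain ⟨k, hk⟩ : ∃ k, x k ≠ 0 := by
    by_contra! h
    simp [h] at hρ
  set p : ℝ := Complex.normSq (x k) with hp
  have hp0 : 0 < p := Complex.normSq_pos.2 hk
  obtain ⟨u, hu⟩ : ∃ u : ℂ, u ^ 2 = -(Λ k * p) := IsAlgClosed.exists_pow_nat_eq _ (by norm_num)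
  have hu0 : u ≠ 0 := by
    rintro rfl
    simp [hΛ.ne_zero k, hp0.ne'] at hu
  set M : ℝ := Complex.normSq u + p with hM
  have hM0 : 0 < M := add_pos_of_nonneg_of_pos (Complex.normSq_nonneg u) hp0
  set q : ℝ := (1 + M)⁻¹ with hq
  have hq0 : 0 < q := by positivity
  have hqM : q ^ 2 * M < 1 := by
    have h₁ : q * (1 + M) = 1 := inv_mul_cancel₀ (by positivity)
    nlinarith [mul_pos hq0 hM0]
  let c : Fin n → ℝ := fun j => (if j = k then 1 else 0) - M
  have hpos : ∀ j t, 0 < 1 + q ^ 2 * c j * Real.sin t ^ 2 := by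
    intro j t
    have h₁ : -M ≤ c j := by
      simp only [c]
      split_ifs <;> linarith
    have h₂ : q ^ 2 * Real.sin t ^ 2 * (-M) ≤ q ^ 2 * Real.sin t ^ 2 * c j := by gcongr
    have h₃ : q ^ 2 * M * Real.sin t ^ 2 ≤ q ^ 2 * M * 1 := by
      gcongr
      exact Real.sin_sq_le_one t
    nlinarith
  let r₀ : Fin s := ⟨0, hs⟩
  let v : Fin s → ℂ := Pi.single r₀ u
  let g : ℝ → ℝ := fun t => q * Real.sin t
  let f : Fin n → ℝ → ℝ := fun j t => √(1 + q ^ 2 * c j * Real.sin t ^ 2)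
  have hgs : ContDiff ℝ (⊤ : ℕ∞) g := contDiff_const.mul Real.contDiff_sin
  have hfs : ∀ j, ContDiff ℝ (⊤ : ℕ∞) (f j) := fun j =>
    (contDiff_const.add (contDiff_const.mul (Real.contDiff_sin.pow 2))).sqrt
      fun t => (hpos j t).ne'
  have hf2 : ∀ j t, f j t * f j t = 1 + q ^ 2 * c j * Real.sin t ^ 2 := fun j t =>
    Real.mul_self_sqrt (hpos j t).le
  have hg' : ∀ t, HasDerivAt g (q * Real.cos t) t := fun t =>
    (Real.hasDerivAt_sin t).const_mul q
  have hder : ∀ t, HasDerivAt (fun t => ((fun r => (g t : ℂ) * v r, fun j => (f j t : ℂ) * x j) :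
      (Fin s → ℂ) × (Fin n → ℂ)))
      (fun r => ((q * Real.cos t : ℝ) : ℂ) * v r, fun j => ((deriv (f j) t : ℝ) : ℂ) * x j) t :=
    fun t => hasDerivAt_real_scaling v x (hg' t) fun j =>
      ((hfs j).differentiable (by simp) t).hasDerivAt
  refine ⟨fun t => (fun r => (g t : ℂ) * v r, fun j => (f j t : ℂ) * x j), ?_, ?_, ?_, ?_, ?_⟩
  · refine ContDiff.prodMk (contDiff_pi.2 fun r => ?_) (contDiff_pi.2 fun j => ?_)
    · exact (Complex.ofRealCLM.contDiff.comp hgs).mul contDiff_const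
    · exact (Complex.ofRealCLM.contDiff.comp (hfs j)).mul contDiff_const
  · ext <;> simp [g, f]
  · intro t _
    have hsum : ∀ j, Complex.normSq ((f j t : ℂ) * x j) = (1 - q ^ 2 * Real.sin t ^ 2 * M) *
        Complex.normSq (x j) + if j = k then q ^ 2 * Real.sin t ^ 2 * p else 0 := by
      intro j
      rw [Complex.normSq_mul, Complex.normSq_ofReal, hf2]
      by_cases h : j = k
      · subst h
        simp only [c, if_true, hp]
        ring
      · simp only [c, h, if_false]
        ring
    refine ⟨?_, ?_⟩
    · have h₁ : ∑ r, ((g t : ℂ) * v r) ^ 2 = ((q * Real.sin t : ℝ) : ℂ) ^ 2 * u ^ 2 := by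
        rw [Finset.sum_eq_single r₀]
        · simp [v, g, mul_pow]
        · intro r _ hr
          simp [v, hr]
        · simp
      have h₂ : ∑ j, Λ j * (Complex.normSq ((f j t : ℂ) * x j) : ℂ) =
          ((1 - q ^ 2 * Real.sin t ^ 2 * M : ℝ) : ℂ) * ∑ j, Λ j * (Complex.normSq (x j) : ℂ)
            + Λ k * ((q ^ 2 * Real.sin t ^ 2 * p : ℝ) : ℂ) := by
        rw [Finset.mul_sum]
        have h₃ : Λ k * ((q ^ 2 * Real.sin t ^ 2 * p : ℝ) : ℂ) =
            ∑ j, if j = k then Λ j * ((q ^ 2 * Real.sin t ^ 2 * p : ℝ) : ℂ) else 0 := by simp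
        rw [h₃, ← Finset.sum_add_distrib]
        refine Finset.sum_congr rfl fun j _ => ?_
        rw [hsum]
        split_ifs <;> push_cast <;> ring
      simp only [h₁, h₂, hF, hu]
      push_cast
      ring
    · have h₁ : ∑ r, Complex.normSq ((g t : ℂ) * v r) =
          q ^ 2 * Real.sin t ^ 2 * Complex.normSq u := by
        rw [Finset.sum_eq_single r₀]
        · simp only [v, g, Pi.single_eq_same, Complex.normSq_mul, Complex.normSq_ofReal]
          ring
        · intro r _ hr
          simp [v, hr]
        · simp
      simp only [h₁, hsum, Finset.sum_add_distrib, ← Finset.mul_sum, hρ, Finset.sum_ite_eq',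
        Finset.mem_univ, if_true, hM]
      ring
  · rintro t ⟨ht₀, ht₁⟩ ⟨-, h⟩
    have hsin : 0 < Real.sin t := Real.sin_pos_of_pos_of_le_one ht₀ ht₁
    have h₁ := congrFun h r₀
    simp only [v, g, Pi.single_eq_same, Pi.zero_apply, mul_eq_zero, hu0, or_false,
      Complex.ofReal_eq_zero, hq0.ne', hsin.ne'] at h₁
  · rintro t ⟨ht₀, ht₁⟩
    rw [(hder t).deriv]
    refine ⟨fun h => ?_, alphaForm_real_scaling v x _ _ (fun j => f j t) _⟩
    have hcos : 0 < Real.cos t := Real.cos_pos_of_le_one (abs_le.2 ⟨by linarith, ht₁⟩)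
    have h₁ := congrFun (congrArg Prod.fst h) r₀
    simp only [v, Pi.single_eq_same, Prod.fst_zero, Pi.zero_apply, mul_eq_zero, hu0, or_false,
      Complex.ofReal_eq_zero, hq0.ne', hcos.ne'] at h₁
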